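/- Let d ≥ 1 and n ≥ 1, let g ∈ ℝ^d be a fixed vector, let α, β ≥ 0, and let v_1, …, v_n ∈ ℝ^d. Then α · (1/n) Σ_{s=1}^n ‖v_s‖² + β · (1/n) Σ_{s=1}^n (Σ_{i=1}^d g_i (v_s)_i)² ≤ (1/n) Σ_{s=1}^n ‖c ⊙ v_s‖², where c ∈ ℝ^d is the vector with entries c_i = √(β · d · g_i² + α). (This is the paper's Bounding Theorem (Theorem 1) in the rigorous case where the gradient vector g = ∂ℓ/∂y is the same for every sample, so that E[(∂ℓ/∂y)²] has entries g_i².) -/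

import Mathlib

open Finset

/-- **Bounding Theorem** (Theorem 1 of the paper, rigorous fixed-gradient case).
For `d, n ≥ 1`, a fixed gradient vector `g ∈ ℝ^d`, weights `α, β ≥ 0`, and samples
`v_1, …, v_n ∈ ℝ^d`, we have
`α · (1/n) Σ_s ‖v_s‖² + β · (1/n) Σ_s (Σ_i g_i (v_s)_i)² ≤ (1/n) Σ_s ‖c ⊙ v_s‖²`
where `c_i = √(β d g_i² + α)`. -/
theorem bounding_theorem (d n : ℕ) (hd : 1 ≤ d) (hn : 1 ≤ n)
    (g : Fin d → ℝ) (α β : ℝ) (hα : 0 ≤ α) (hβ : 0 ≤ β)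
    (v : Fin n → Fin d → ℝ) :
    α * ((n : ℝ)⁻¹ * ∑ s, ∑ i, (v s i) ^ 2)
      + β * ((n : ℝ)⁻¹ * ∑ s, (∑ i, g i * v s i) ^ 2)
      ≤ (n : ℝ)⁻¹ * ∑ s, ∑ i, (Real.sqrt (β * (d : ℝ) * (g i) ^ 2 + α) * v s i) ^ 2 := by
  have key (s : Fin n) : α * ∑ i, (v s i) ^ 2 + β * (∑ i, g i * v s i) ^ 2
      ≤ ∑ i, (Real.sqrt (β * (d : ℝ) * (g i) ^ 2 + α) * v s i) ^ 2 := by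
    have cauchy : (∑ i, g i * v s i) ^ 2 ≤ (d : ℝ) * ∑ i, (g i * v s i) ^ 2 := by
      simpa using sq_sum_le_card_mul_sum_sq (s := univ) (f := fun i => g i * v s i)
    calc α * ∑ i, (v s i) ^ 2 + β * (∑ i, g i * v s i) ^ 2
        ≤ α * ∑ i, (v s i) ^ 2 + β * ((d : ℝ) * ∑ i, (g i * v s i) ^ 2) := by gcongr
      _ = ∑ i, (Real.sqrt (β * (d : ℝ) * (g i) ^ 2 + α) * v s i) ^ 2 := by
        simp only [mul_sum, ← sum_add_distrib]
        refine sum_congr rfl fun i _ => ?_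
        rw [mul_pow (Real.sqrt _), Real.sq_sqrt (by positivity)]
        ring
  calc _ = (n : ℝ)⁻¹ * ∑ s, (α * ∑ i, (v s i) ^ 2 + β * (∑ i, g i * v s i) ^ 2) := by
        rw [sum_add_distrib, ← mul_sum, ← mul_sum]
        ring
    _ ≤ _ := by
        gcongr with s
        exact key s
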